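/- For each $n$, let $Q_n$ be the $n \times n$ random symmetric matrix whose entries $\xi_{ij}$ for $1 \leq i \leq j \leq n$ are i.i.d. random variables taking values $0$ and $1$ each with probability $1/2$, with $\xi_{ji} = \xi_{ij}$. Then $\mathbb{P}(\det Q_n \neq 0) \to 1$ as $n \to \infty$. -/

import Mathlib

open Filter

open Finset

/-- The symmetric `0`-`1` matrix determined by the entries of `s` on and above the diagonal. -/
def symBernoulli (R : Type*) [Zero R] [One R] {n : ℕ} (s : Fin n → Fin n → Bool) :
    Matrix (Fin n) (Fin n) R :=
  Matrix.of fun i j => if i ≤ j then (if s i j then 1 else 0) else (if s j i then 1 else 0)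

/-- The coefficient of the entry `(i, j)`, for `i ≤ j`, in the bilinear form `w ⬝ᵥ M *ᵥ v` of a
symmetric matrix `M`; it is zero for `j < i`. -/
def pairCoeff {R : Type*} [CommRing R] {n : ℕ} (v w : Fin n → R) (i j : Fin n) : R :=
  (if i ≤ j then w i * v j else 0) + (if i < j then w j * v i else 0)

lemma dotProduct_symBernoulli_mulVec {R : Type*} [CommRing R] {n : ℕ}
    (s : Fin n → Fin n → Bool) (v w : Fin n → R) :
    w ⬝ᵥ (symBernoulli R s).mulVec v = ∑ i, ∑ j, if s i j then pairCoeff v w i j else 0 := by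
  have key : ∀ i j, w i * (symBernoulli R s i j * v j) =
      (if s i j then (if i ≤ j then w i * v j else 0) else 0) +
      (if s j i then (if j < i then w i * v j else 0) else 0) := by
    intro i j
    simp only [symBernoulli, Matrix.of_apply]
    by_cases h : i ≤ j
    · simp [h, not_lt.mpr h]
    · simp [h, not_le.mp h]
  simp only [dotProduct, Matrix.mulVec, Finset.mul_sum, key, Finset.sum_add_distrib]
  rw [Finset.sum_comm (f := fun i j => if s j i then (if j < i then w i * v j else 0) else 0)]
  simp only [← Finset.sum_add_distrib]
  refine Finset.sum_congr rfl fun i _ => Finset.sum_congr rfl fun j _ => ?_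
  by_cases h : s i j <;> simp [h, pairCoeff]

lemma addChar_map_sum {A M ι : Type*} [AddCommMonoid A] [CommMonoid M] (ψ : AddChar A M)
    (t : Finset ι) (f : ι → A) : ψ (∑ i ∈ t, f i) = ∏ i ∈ t, ψ (f i) :=
  map_prod ψ.toMonoidHom (fun i => Multiplicative.ofAdd (f i)) t

lemma sum_addChar_bool {A : Type*} [AddCommGroup A] (ψ : AddChar A ℂ) {n : ℕ}
    (c : Fin n → Fin n → A) :
    ∑ s : Fin n → Fin n → Bool, ψ (∑ i, ∑ j, if s i j then c i j else 0) =
      ∏ i, ∏ j, (1 + ψ (c i j)) := by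
  have h1 : ∀ i, ∏ j, (1 + ψ (c i j)) = ∑ t : Fin n → Bool, ∏ j, ψ (if t j then c i j else 0) := by
    intro i
    rw [← Fintype.prod_sum (fun j (b : Bool) => ψ (if b then c i j else 0))]
    simp [add_comm]
  simp only [h1]
  rw [Fintype.prod_sum (fun i (t : Fin n → Bool) => ∏ j, ψ (if t j then c i j else 0))]
  simp only [addChar_map_sum]

lemma sum_stdAddChar_dotProduct {p : ℕ} [Fact p.Prime] {n : ℕ} (u : Fin n → ZMod p) :
    ∑ w : Fin n → ZMod p, ZMod.stdAddChar (w ⬝ᵥ u) = if u = 0 then (p : ℂ) ^ n else 0 := by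
  simp only [dotProduct, addChar_map_sum]
  rw [← Fintype.prod_sum (fun i (a : ZMod p) => ZMod.stdAddChar (a * u i))]
  have (i : Fin n) : ∑ a : ZMod p, ZMod.stdAddChar (a * u i) = if u i = 0 then (p : ℂ) else 0 := by
    rw [AddChar.sum_mulShift _ (ZMod.isPrimitive_stdAddChar p)]; simp
  simp only [this]
  by_cases hu : u = 0
  · simp [hu]
  · obtain ⟨i, hi⟩ := Function.ne_iff.mp hu
    rw [if_neg hu]
    exact Finset.prod_eq_zero (Finset.mem_univ i) (if_neg hi)

lemma exists_norm_one_add_stdAddChar_le (p : ℕ) [Fact p.Prime] : ∃ r : ℝ, 0 < r ∧ r < 1 ∧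
    ∀ c : ZMod p, c ≠ 0 → ‖1 + ZMod.stdAddChar c‖ ≤ 2 * r ^ 4 := by
  have hlt : ∀ c : ZMod p, c ≠ 0 → ‖1 + ZMod.stdAddChar c‖ < 2 := by
    intro c hc
    have h1 : ‖(ZMod.stdAddChar c : ℂ)‖ = 1 := AddChar.norm_apply _ _
    have h2 : (1 : ℂ) ≠ ZMod.stdAddChar c := by
      intro h
      apply hc
      apply ZMod.injective_stdAddChar
      rw [← h, AddChar.map_zero_eq_one]
    have h3 := (norm_add_lt_of_not_sameRay (x := (1 : ℂ)) (y := ZMod.stdAddChar c) (by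
      rw [sameRay_iff_of_norm_eq (by simp [h1])]; exact h2))
    rw [h1, norm_one] at h3
    linarith
  obtain ⟨ρ, hρ0, hρ1, hρ⟩ : ∃ ρ : ℝ, 0 < ρ ∧ ρ < 1 ∧
      ∀ c : ZMod p, c ≠ 0 → ‖1 + ZMod.stdAddChar c‖ ≤ 2 * ρ := by
    have hne : (Finset.univ : Finset (ZMod p)).Nonempty := Finset.univ_nonempty
    obtain ⟨c, -, hc⟩ := Finset.exists_max_image Finset.univ
      (fun c : ZMod p => if c = 0 then 1 else ‖1 + ZMod.stdAddChar c‖) hne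
    refine ⟨(if c = 0 then 1 else ‖1 + ZMod.stdAddChar c‖) / 2, ?_, ?_, ?_⟩
    · have := hc 0 (Finset.mem_univ _)
      rw [if_pos rfl] at this
      linarith
    · split_ifs with h
      · norm_num
      · linarith [hlt c h]
    · intro d hd
      have := hc d (Finset.mem_univ _)
      rw [if_neg hd] at this
      linarith
  refine ⟨√√ρ, by positivity, ?_, fun c hc => ?_⟩
  · rw [Real.sqrt_lt' one_pos, Real.sqrt_lt' (by norm_num)]; simpa using hρ1
  · have : √√ρ ^ 4 = ρ := by
      rw [show 4 = 2 * 2 from rfl, pow_mul, Real.sq_sqrt (by positivity), Real.sq_sqrt hρ0.le]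
    rw [this]; exact hρ c hc

lemma card_eq_neg_le {ι κ : Type*} [Fintype κ] [DecidableEq κ] [InvolutiveNeg κ]
    (C : Finset ι) (f : ι → κ) :
    #{x ∈ C ×ˢ C | f x.1 = - f x.2} ≤ #{x ∈ C ×ˢ C | f x.1 = f x.2} := by
  have h1 : ∀ σ : κ → κ, #{x ∈ C ×ˢ C | f x.1 = σ (f x.2)} =
      ∑ k, #{i ∈ C | f i = σ k} * #{i ∈ C | f i = k} := by
    intro σ
    rw [Finset.card_eq_sum_card_fiberwise (f := fun x => f x.2) (t := Finset.univ) (by simp)]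
    refine Finset.sum_congr rfl fun k _ => ?_
    rw [← Finset.card_product]
    congr 1
    ext x
    simp only [mem_filter, mem_product]
    constructor
    · rintro ⟨⟨⟨h1, h2⟩, h3⟩, rfl⟩; exact ⟨⟨h1, h3⟩, h2, rfl⟩
    · rintro ⟨⟨h1, h3⟩, h2, rfl⟩; exact ⟨⟨⟨h1, h2⟩, h3⟩, rfl⟩
  have e1 := h1 Neg.neg
  have e2 := h1 id
  simp only [id] at e2
  rw [e1, e2]
  have h3 : ∑ k, #{i ∈ C | f i = -k} * #{i ∈ C | f i = -k} =
      ∑ k, #{i ∈ C | f i = k} * #{i ∈ C | f i = k} :=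
    Equiv.sum_comp (Equiv.neg κ) fun k => #{i ∈ C | f i = k} * #{i ∈ C | f i = k}
  have h4 : ∑ k, 2 * (#{i ∈ C | f i = -k} * #{i ∈ C | f i = k}) ≤
      ∑ k, (#{i ∈ C | f i = -k} * #{i ∈ C | f i = -k} +
        #{i ∈ C | f i = k} * #{i ∈ C | f i = k}) := by
    refine Finset.sum_le_sum fun k _ => ?_
    have := two_mul_le_add_sq (#{i ∈ C | f i = -k}) (#{i ∈ C | f i = k})
    nlinarith
  rw [Finset.sum_add_distrib, h3, ← Finset.mul_sum] at h4
  omega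

lemma card_support_mul_card_support_le {K ι : Type*} [Field K] [Fintype K] [DecidableEq K]
    (h2 : (2 : K) ≠ 0) [Fintype ι] (v w : ι → K) :
    #{i | v i ≠ 0} * #{j | w j ≠ 0} ≤
      2 * #{x : ι × ι | w x.1 * v x.2 + w x.2 * v x.1 ≠ 0} := by
  classical
  set C : Finset ι := {i | v i ≠ 0 ∧ w i ≠ 0} with hC
  have hO : #{x ∈ C ×ˢ C | w x.1 / v x.1 = -(w x.2 / v x.2)} ≤
      #{x : ι × ι | w x.1 * v x.2 + w x.2 * v x.1 ≠ 0} := by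
    refine (card_eq_neg_le C fun i => w i / v i).trans (Finset.card_le_card fun x hx => ?_)
    simp only [hC, mem_filter, mem_product, mem_univ, true_and] at hx ⊢
    obtain ⟨⟨⟨h1, h3⟩, h4, h5⟩, h6⟩ := hx
    rw [div_eq_div_iff h1 h4] at h6
    rw [h6, ← two_mul]
    exact mul_ne_zero h2 (mul_ne_zero h5 h1)
  rw [← Finset.card_product, two_mul]
  refine le_trans (Finset.card_le_card (t := {x ∈ C ×ˢ C | w x.1 / v x.1 = -(w x.2 / v x.2)} ∪
    ({x : ι × ι | w x.1 * v x.2 + w x.2 * v x.1 ≠ 0} : Finset (ι × ι))) fun x hx => ?_) <|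
    (Finset.card_union_le _ _).trans (Nat.add_le_add_right hO _)
  simp only [hC, mem_filter, mem_product, mem_univ, true_and, mem_union] at hx ⊢
  obtain ⟨h1, h4⟩ := hx
  by_cases h : w x.1 * v x.2 + w x.2 * v x.1 = 0
  · left
    have h5 : w x.1 * v x.2 ≠ 0 := by
      intro h6
      rw [h6, zero_add] at h
      exact mul_ne_zero h4 h1 h
    have h6 := left_ne_zero_of_mul h5
    have h7 := right_ne_zero_of_mul h5
    refine ⟨⟨⟨h1, h6⟩, h7, h4⟩, ?_⟩
    rw [← neg_div, div_eq_div_iff h1 h7]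
    linear_combination h
  · exact .inr h

lemma card_ne_zero_le_pairCoeff {R : Type*} [CommRing R] [DecidableEq R]
    {n : ℕ} (v w : Fin n → R) :
    #{x : Fin n × Fin n | w x.1 * v x.2 + w x.2 * v x.1 ≠ 0} ≤
      2 * #{x : Fin n × Fin n | pairCoeff v w x.1 x.2 ≠ 0} := by
  set N : Finset (Fin n × Fin n) := {x | pairCoeff v w x.1 x.2 ≠ 0} with hN
  have mem_N (i j : Fin n) : (i, j) ∈ N ↔ pairCoeff v w i j ≠ 0 := by simp [hN]
  have : #(N.image Prod.swap) ≤ #N := Finset.card_image_le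
  refine le_trans (Finset.card_le_card (t := N ∪ N.image Prod.swap) fun x hx => ?_)
    ((Finset.card_union_le _ _).trans (by omega))
  obtain ⟨i, j⟩ := x
  simp only [mem_filter, mem_univ, true_and, mem_union, mem_image, Prod.exists] at hx ⊢
  rcases lt_trichotomy i j with h | rfl | h
  · left
    rw [mem_N]
    simpa [pairCoeff, h, h.le] using hx
  · left
    rw [mem_N]
    intro h
    simp only [pairCoeff, le_refl, if_true, lt_irrefl, if_false, add_zero] at h
    simp [h] at hx
  · right
    refine ⟨j, i, ?_, rfl⟩
    rw [mem_N]
    simpa [pairCoeff, h, h.le, add_comm] using hx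

lemma sum_pow_card_support {p : ℕ} [Fact p.Prime] {n : ℕ} (y : ℝ) :
    ∑ w : Fin n → ZMod p, y ^ #{i | w i ≠ 0} = (1 + (p - 1) * y) ^ n := by
  have h1 : ∑ a : ZMod p, (if a ≠ 0 then y else 1) = 1 + (p - 1) * y := by
    rw [Finset.sum_ite]
    simp [Finset.filter_ne', Nat.cast_sub (Fact.out : p.Prime).one_le, Finset.filter_eq']
    ring
  rw [← h1, Fintype.sum_pow]
  refine Finset.sum_congr rfl fun w _ => ?_
  rw [Finset.prod_ite]; simp

lemma card_mulVec_eq_zero_le {p : ℕ} [Fact p.Prime] {r : ℝ} (hr0 : 0 < r)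
    (hr1 : r < 1) (hp : (2 : ZMod p) ≠ 0)
    (hr : ∀ c : ZMod p, c ≠ 0 → ‖1 + ZMod.stdAddChar c‖ ≤ 2 * r ^ 4) {n : ℕ}
    (v : Fin n → ZMod p) :
    (#{s | (symBernoulli (ZMod p) s).mulVec v = 0} : ℝ) ≤
      2 ^ (n * n) * ((1 + (p - 1) * r ^ #{i | v i ≠ 0}) / p) ^ n := by
  have hp0 : (0 : ℝ) < p := by exact_mod_cast (Fact.out : p.Prime).pos
  have h1 : (#{s | (symBernoulli (ZMod p) s).mulVec v = 0} : ℂ) * p ^ n =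
      ∑ w, ∏ i, ∏ j, (1 + ZMod.stdAddChar (pairCoeff v w i j)) := by
    simp only [← sum_addChar_bool, ← dotProduct_symBernoulli_mulVec]
    rw [Finset.sum_comm]
    simp only [sum_stdAddChar_dotProduct]
    rw [Finset.sum_ite]
    simp
  have h2 : ∀ w : Fin n → ZMod p,
      ‖∏ i, ∏ j, (1 + ZMod.stdAddChar (pairCoeff v w i j))‖ ≤
        2 ^ (n * n) * (r ^ #{i | v i ≠ 0}) ^ #{i | w i ≠ 0} := by
    intro w
    calc ‖∏ i, ∏ j, (1 + ZMod.stdAddChar (pairCoeff v w i j))‖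
        = ∏ x : Fin n × Fin n, ‖1 + ZMod.stdAddChar (pairCoeff v w x.1 x.2)‖ := by
          rw [← Finset.univ_product_univ, Finset.prod_product]
          simp only [norm_prod]
      _ ≤ ∏ x : Fin n × Fin n, 2 * (if pairCoeff v w x.1 x.2 ≠ 0 then r ^ 4 else 1) := by
          refine Finset.prod_le_prod (fun _ _ => norm_nonneg _) fun x _ => ?_
          split_ifs with h
          · exact hr _ h
          · rw [not_not.mp h, AddChar.map_zero_eq_one]
            norm_num
      _ = 2 ^ (n * n) * r ^ (4 * #{x : Fin n × Fin n | pairCoeff v w x.1 x.2 ≠ 0}) := by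
          rw [Finset.prod_mul_distrib, Finset.prod_ite]
          simp [pow_mul]
      _ ≤ _ := by
          rw [← pow_mul]
          refine mul_le_mul_of_nonneg_left (pow_le_pow_of_le_one hr0.le hr1.le ?_) (by positivity)
          have := card_support_mul_card_support_le hp v w
          have := card_ne_zero_le_pairCoeff v w
          omega
  have h3 : (#{s | (symBernoulli (ZMod p) s).mulVec v = 0} : ℝ) * p ^ n ≤
      2 ^ (n * n) * (1 + (p - 1) * r ^ #{i | v i ≠ 0}) ^ n := by
    calc _ = ‖(#{s | (symBernoulli (ZMod p) s).mulVec v = 0} : ℂ) * p ^ n‖ := by simp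
      _ ≤ ∑ w : Fin n → ZMod p, 2 ^ (n * n) * (r ^ #{i | v i ≠ 0}) ^ #{i | w i ≠ 0} := by
        rw [h1]
        exact norm_sum_le_of_le _ fun w _ => h2 w
      _ = _ := by rw [← Finset.mul_sum, sum_pow_card_support]
  rw [div_pow, ← mul_div_assoc, le_div_iff₀ (by positivity)]
  exact h3

lemma sum_pow_card_support_le {p : ℕ} [Fact p.Prime] {r x : ℝ} (hr0 : 0 < r)
    (hr1 : r < 1) (hx0 : 0 < x) (hx1 : x ≤ 1)
    (n m : ℕ) :
    ∑ v : Fin n → ZMod p with v ≠ 0, ((1 + (p - 1) * r ^ #{i | v i ≠ 0}) / p) ^ n ≤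
      (1 + (p - 1) * r ^ m) ^ n + ((1 + (p - 1) * x) * ((1 + (p - 1) * r) / p)) ^ n / x ^ m := by
  have hp1 : (0 : ℝ) ≤ p - 1 := by
    rw [sub_nonneg]; exact_mod_cast (Fact.out : p.Prime).one_le
  have hp0 : (0 : ℝ) < p := by linarith
  calc _ ≤ ∑ v : Fin n → ZMod p with v ≠ 0, (((1 + (p - 1) * r ^ m) / p) ^ n +
          ((1 + (p - 1) * r) / p) ^ n / x ^ m * x ^ #{i | v i ≠ 0}) := by
        refine Finset.sum_le_sum fun v hv => ?_
        obtain ⟨i, hi⟩ := Function.ne_iff.mp (Finset.mem_filter.mp hv).2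
        have hv1 : 1 ≤ #{i | v i ≠ 0} := Finset.card_pos.mpr ⟨i, by simpa using hi⟩
        rcases le_total m #{i | v i ≠ 0} with h | h
        · refine le_add_of_le_of_nonneg ?_ (by positivity)
          have := pow_le_pow_of_le_one hr0.le hr1.le h
          gcongr
        · refine le_add_of_nonneg_of_le (by positivity) ?_
          have h1 := pow_le_pow_of_le_one hr0.le hr1.le hv1
          rw [pow_one] at h1
          have h2 : 1 ≤ x ^ #{i | v i ≠ 0} / x ^ m := by
            rw [one_le_div (by positivity)]
            exact pow_le_pow_of_le_one hx0.le hx1 h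
          rw [div_mul_eq_mul_div, mul_div_assoc]
          refine le_trans ?_ (le_mul_of_one_le_right (by positivity) h2)
          gcongr
    _ ≤ ∑ v : Fin n → ZMod p, (((1 + (p - 1) * r ^ m) / p) ^ n +
          ((1 + (p - 1) * r) / p) ^ n / x ^ m * x ^ #{i | v i ≠ 0}) :=
        Finset.sum_le_sum_of_subset_of_nonneg (Finset.filter_subset _ _)
          fun v _ _ => by positivity
    _ = _ := by
        rw [Finset.sum_add_distrib, ← Finset.mul_sum, sum_pow_card_support]
        simp only [sum_const, card_univ, Fintype.card_fun, ZMod.card, Fintype.card_fin,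
          nsmul_eq_mul, Nat.cast_pow, div_pow, mul_pow]
        field_simp

lemma exists_eventually_le_two {P r : ℝ} (hP : 1 < P) (hr0 : 0 < r) (hr1 : r < 1) :
    ∃ x : ℝ, 0 < x ∧ x ≤ 1 ∧ ∃ K : ℕ, ∀ᶠ n : ℕ in atTop,
      (1 + (P - 1) * r ^ (n / K)) ^ n +
        ((1 + (P - 1) * x) * ((1 + (P - 1) * r) / P)) ^ n / x ^ (n / K) ≤ 2 := by
  have hP1 : 0 < P - 1 := by linarith
  set q := (1 + (P - 1) * r) / P with hq
  have hq0 : 0 < q := by positivity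
  have hq1 : q < 1 := by
    rw [hq, div_lt_one (by linarith)]
    nlinarith
  set x := (1 - q) / (2 * P) with hx
  have hx0 : 0 < x := div_pos (by linarith) (by linarith)
  have hxP : x * (2 * P) = 1 - q := by rw [hx]; field_simp
  have hx1 : x ≤ 1 := by nlinarith
  set b := (1 + (P - 1) * x) * q
  have hb0 : 0 < b := by positivity
  have hb1 : b < 1 := by nlinarith
  obtain ⟨K, hK⟩ := exists_pow_lt_of_lt_one hx0 hb1
  have hK0 : 0 < K := by
    rcases Nat.eq_zero_or_pos K with rfl | h
    · rw [pow_zero] at hK; linarith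
    · exact h
  refine ⟨x, hx0, hx1, K, ?_⟩
  have hdiv : Tendsto (fun n : ℕ => n / K) atTop atTop := Nat.tendsto_div_const_atTop hK0.ne'
  have hlim1 : Tendsto (fun m : ℕ => Real.exp (K * (m + 1) * (P * r ^ m))) atTop (nhds 1) := by
    have h1 := tendsto_self_mul_const_pow_of_lt_one hr0.le hr1
    have h2 := tendsto_pow_atTop_nhds_zero_of_lt_one hr0.le hr1
    have h3 : Tendsto (fun m : ℕ => K * P * ((m : ℝ) * r ^ m + r ^ m)) atTop (nhds 0) := by
      simpa using (h1.add h2).const_mul (K * P)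
    have h4 : Tendsto (fun m : ℕ => (K : ℝ) * (m + 1) * (P * r ^ m)) atTop (nhds 0) :=
      h3.congr fun m => by ring
    simpa only [Real.exp_zero] using h4.rexp
  have hlim2 : Tendsto (fun m : ℕ => (b ^ K / x) ^ m) atTop (nhds 0) :=
    tendsto_pow_atTop_nhds_zero_of_lt_one (by positivity) ((div_lt_one hx0).mpr hK)
  have hlim : Tendsto (fun m : ℕ => Real.exp (K * (m + 1) * (P * r ^ m)) + (b ^ K / x) ^ m)
      atTop (nhds 1) := by
    simpa using hlim1.add hlim2
  filter_upwards [hdiv.eventually (hlim.eventually (eventually_le_nhds one_lt_two))] with n hn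
  refine le_trans (add_le_add ?_ ?_) hn
  · calc (1 + (P - 1) * r ^ (n / K)) ^ n ≤ Real.exp (P * r ^ (n / K)) ^ n := by
          have h := Real.add_one_le_exp (P * r ^ (n / K))
          have : 0 < r ^ (n / K) := by positivity
          gcongr
          linarith
      _ = Real.exp (n * (P * r ^ (n / K))) := by rw [← Real.exp_nat_mul]
      _ ≤ _ := by
          have : (n : ℝ) ≤ K * (↑(n / K) + 1) := by
            exact_mod_cast (Nat.lt_mul_div_succ n hK0).le
          gcongr
  · rw [div_pow (b ^ K), ← pow_mul]
    have : b ^ n ≤ b ^ (K * (n / K)) := pow_le_pow_of_le_one hb0.le hb1.le (Nat.mul_div_le n K)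
    gcongr

lemma card_det_eq_zero_mul_le {p : ℕ} [Fact p.Prime] {n : ℕ} :
    #{s : Fin n → Fin n → Bool | (symBernoulli (ZMod p) s).det = 0} * (p - 1) ≤
      ∑ v : Fin n → ZMod p with v ≠ 0, #{s | (symBernoulli (ZMod p) s).mulVec v = 0} := by
  simp only [Finset.card_filter (fun s => (symBernoulli (ZMod p) s).mulVec _ = 0)]
  rw [Finset.sum_comm]
  simp only [← Finset.card_filter]
  refine le_trans ?_ (Finset.sum_le_sum_of_subset (Finset.filter_subset
    (fun s : Fin n → Fin n → Bool => (symBernoulli (ZMod p) s).det = 0) _))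
  rw [← smul_eq_mul]
  refine Finset.card_nsmul_le_sum _ _ _ fun s hs => ?_
  obtain ⟨v, hv0, hv⟩ := Matrix.exists_mulVec_eq_zero_iff.mpr (Finset.mem_filter.mp hs).2
  have hcard : #{c : ZMod p | c ≠ 0} = p - 1 := by
    rw [Finset.filter_ne', Finset.card_erase_of_mem (Finset.mem_univ _), Finset.card_univ,
      ZMod.card]
  rw [← hcard]
  refine Finset.card_le_card_of_injOn (fun c => c • v) (fun c hc => ?_)
    (smul_left_injective _ hv0).injOn
  have hc0 : c ≠ 0 := by simpa using hc
  simp [Matrix.mulVec_smul, hv, hv0, hc0]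

lemma det_symBernoulli_zmod_eq_zero {p : ℕ} [Fact p.Prime] {n : ℕ} {s : Fin n → Fin n → Bool}
    (h : (symBernoulli ℝ s).det = 0) : (symBernoulli (ZMod p) s).det = 0 := by
  have hmap {R : Type} [CommRing R] :
      (symBernoulli R s).det = (((symBernoulli ℤ s).det : ℤ) : R) := by
    rw [Int.cast_det]
    congr 1
    ext i j
    simp only [symBernoulli, Matrix.of_apply, Matrix.map_apply]
    split_ifs <;> simp
  rw [hmap, Int.cast_eq_zero] at h
  rw [hmap, h, Int.cast_zero]

/-- Proportionally at most `2 / (p - 1)` of the matrices are singular: the expected number of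
nonzero kernel vectors modulo `p` is eventually at most `2`, and a nontrivial kernel has at least
`p - 1` of them. -/
lemma eventually_card_det_eq_zero_mul_le {p : ℕ} [Fact p.Prime] (hp2 : p ≠ 2) : ∀ᶠ n : ℕ in atTop,
    (#{s : Fin n → Fin n → Bool | (symBernoulli ℝ s).det = 0} : ℝ) * (p - 1) ≤
      2 * 2 ^ (n * n) := by
  have hp : p.Prime := Fact.out
  have h2 : (2 : ZMod p) ≠ 0 := by
    have := (ZMod.natCast_eq_zero_iff 2 p).not.mpr
      fun h => hp2 ((Nat.prime_dvd_prime_iff_eq hp Nat.prime_two).mp h)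
    exact_mod_cast this
  obtain ⟨r, hr0, hr1, hr⟩ := exists_norm_one_add_stdAddChar_le p
  obtain ⟨x, hx0, hx1, K, hK⟩ :=
    exists_eventually_le_two (P := p) (by exact_mod_cast hp.one_lt) hr0 hr1
  filter_upwards [hK] with n hn
  calc (#{s : Fin n → Fin n → Bool | (symBernoulli ℝ s).det = 0} : ℝ) * (p - 1)
      ≤ #{s : Fin n → Fin n → Bool | (symBernoulli (ZMod p) s).det = 0} * (p - 1) := by
        have : (1 : ℝ) ≤ p := by exact_mod_cast hp.one_le
        refine mul_le_mul_of_nonneg_right ?_ (by linarith)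
        exact_mod_cast Finset.card_le_card
          (Finset.monotone_filter_right _ fun s _ => det_symBernoulli_zmod_eq_zero)
    _ ≤ ∑ v : Fin n → ZMod p with v ≠ 0,
          (#{s | (symBernoulli (ZMod p) s).mulVec v = 0} : ℝ) := by
        have := card_det_eq_zero_mul_le (p := p) (n := n)
        rw [← Nat.cast_le (α := ℝ)] at this
        simpa [Nat.cast_sub hp.one_le] using this
    _ ≤ ∑ v : Fin n → ZMod p with v ≠ 0,
          2 ^ (n * n) * ((1 + (p - 1) * r ^ #{i | v i ≠ 0}) / p) ^ n :=
        Finset.sum_le_sum fun v _ => card_mulVec_eq_zero_le hr0 hr1 h2 hr v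
    _ ≤ 2 ^ (n * n) * 2 := by
        rw [← Finset.mul_sum]
        exact mul_le_mul_of_nonneg_left
          ((sum_pow_card_support_le hr0 hr1 hx0 hx1 n (n / K)).trans hn) (by positivity)
    _ = _ := mul_comm _ _

/-- **Costello–Tao–Vu theorem.** Let `Qₙ` be the `n × n` random symmetric matrix whose
upper diagonal entries (`i ≤ j`) are i.i.d., equal to `1` or `0` each with probability
`1/2` (modeled by a uniform `s : Fin n → Fin n → Bool`, only the entries with `i ≤ j`
being used and the matrix symmetrized).  Then `ℙ(det Qₙ ≠ 0) → 1` as `n → ∞`. -/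
theorem symmetric_bernoulli_matrix_nonsingular :
    Tendsto (fun n : ℕ =>
        (Nat.card {s : Fin n → Fin n → Bool //
            (Matrix.of fun i j => if i ≤ j then (if s i j then (1 : ℝ) else 0)
              else (if s j i then (1 : ℝ) else 0)).det ≠ 0} : ℝ) / 2 ^ (n * n))
      atTop (nhds 1) := by
  have hcard (n : ℕ) : (Nat.card {s : Fin n → Fin n → Bool // (symBernoulli ℝ s).det ≠ 0} : ℝ) =
      2 ^ (n * n) - #{s : Fin n → Fin n → Bool | (symBernoulli ℝ s).det = 0} := by
    classical
    rw [Nat.card_eq_fintype_card, Fintype.card_subtype, eq_sub_iff_add_eq']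
    have := Finset.card_filter_add_card_filter_not (s := Finset.univ)
      fun s : Fin n → Fin n → Bool => (symBernoulli ℝ s).det = 0
    rw [Finset.card_univ, Fintype.card_fun, Fintype.card_fun, Fintype.card_bool, Fintype.card_fin,
      ← pow_mul] at this
    exact_mod_cast this
  change Tendsto (fun n : ℕ => (Nat.card {s : Fin n → Fin n → Bool //
    (symBernoulli ℝ s).det ≠ 0} : ℝ) / 2 ^ (n * n)) atTop (nhds 1)
  simp only [hcard]
  rw [Metric.tendsto_nhds]
  intro ε hε
  obtain ⟨N, hN⟩ := exists_nat_gt (2 / ε)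
  obtain ⟨p, hpN, hp⟩ := Nat.exists_infinite_primes (N + 3)
  have : Fact p.Prime := ⟨hp⟩
  filter_upwards [eventually_card_det_eq_zero_mul_le (p := p) (by omega)] with n hn
  have hpN' : (N : ℝ) + 3 ≤ p := by exact_mod_cast hpN
  have hεp : 2 < ε * (p - 1) := by
    rw [div_lt_iff₀' hε] at hN
    nlinarith
  have h2 : (0 : ℝ) < 2 ^ (n * n) := by positivity
  have hp1 : (0 : ℝ) < p - 1 := by have : (0 : ℝ) ≤ N := N.cast_nonneg; linarith
  rw [sub_div, div_self h2.ne', Real.dist_eq, sub_sub_cancel_left, abs_neg,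
    abs_of_nonneg (by positivity), div_lt_iff₀ h2]
  nlinarith
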